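/- arXiv:2011.05222 — 5 statements merged into one kernel-verified Lean document; each statement's English description precedes it below -/
import Mathlib

section
/- For all real numbers t ≥ s ≥ 0 one has ∫_s^t |h(τ)| dτ ≤ T^{−1/𝔯}·C_h·(t−s) + C_h·(t−s)^{(𝔯−1)/𝔯}. -/
open MeasureTheory

/-- Local integrability of `|h|^r` makes `h` an `L^r` function on bounded intervals of `[0,∞)`. -/
lemma memLp_restrict_Ioc {r : ℝ} (hr : 1 < r) {h : ℝ → ℝ} (hmeas : Measurable h)
    (hloc : ∀ a b : ℝ, 0 ≤ a → IntegrableOn (fun τ => |h τ| ^ r) (Set.Icc a b))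
    {a : ℝ} (ha : 0 ≤ a) (b : ℝ) :
    MemLp (fun τ => |h τ|) (ENNReal.ofReal r) (volume.restrict (Set.Ioc a b)) := by
  have hr0 : 0 < r := by linarith
  rw [← integrable_norm_rpow_iff hmeas.abs.aestronglyMeasurable
    (by simpa using hr0) ENNReal.ofReal_ne_top, ENNReal.toReal_ofReal hr0.le]
  simpa [IntegrableOn] using (hloc a b ha).mono_set Set.Ioc_subset_Icc_self

lemma intervalIntegrable_abs_of_rpow {r : ℝ} (hr : 1 < r) {h : ℝ → ℝ} (hmeas : Measurable h)
    (hloc : ∀ a b : ℝ, 0 ≤ a → IntegrableOn (fun τ => |h τ| ^ r) (Set.Icc a b))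
    {a b : ℝ} (ha : 0 ≤ a) (hab : a ≤ b) :
    IntervalIntegrable (fun τ => |h τ|) volume a b := by
  rw [intervalIntegrable_iff_integrableOn_Ioc_of_le hab]
  refine (memLp_restrict_Ioc hr hmeas hloc ha b).integrable ?_
  rw [← ENNReal.ofReal_one]
  exact ENNReal.ofReal_le_ofReal hr.le

/-- Hölder's inequality on an interval of length at most `T`. -/
lemma integral_abs_le_of_length_le {T Ch r : ℝ} (hCh : 0 < Ch) (hr : 1 < r)
    {h : ℝ → ℝ} (hmeas : Measurable h)
    (hloc : ∀ a b : ℝ, 0 ≤ a → IntegrableOn (fun τ => |h τ| ^ r) (Set.Icc a b))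
    (hbound : ∀ s : ℝ, 0 ≤ s → (∫ τ in s..(s + T), |h τ| ^ r) ≤ Ch ^ r)
    {a b : ℝ} (ha : 0 ≤ a) (hab : a ≤ b) (hbT : b ≤ a + T) :
    (∫ τ in a..b, |h τ|) ≤ Ch * (b - a) ^ ((r - 1) / r) := by
  have hr0 : 0 < r := by linarith
  have hpq : r.HolderConjugate (Real.conjExponent r) := Real.HolderConjugate.conjExponent hr
  have holder := integral_mul_le_Lp_mul_Lq_of_nonneg (μ := volume.restrict (Set.Ioc a b)) hpq
    (f := fun τ => |h τ|) (g := fun _ => (1 : ℝ))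
    (Filter.Eventually.of_forall fun _ => abs_nonneg _)
    (Filter.Eventually.of_forall fun _ => zero_le_one)
    (memLp_restrict_Ioc hr hmeas hloc ha b) (memLp_const 1)
  have hmono : (∫ τ in Set.Ioc a b, |h τ| ^ r) ≤ Ch ^ r := by
    refine le_trans ?_ (hbound a ha)
    rw [intervalIntegral.integral_of_le (hab.trans hbT)]
    exact setIntegral_mono_set ((hloc a (a + T) ha).mono_set Set.Ioc_subset_Icc_self)
      (Filter.Eventually.of_forall fun _ => Real.rpow_nonneg (abs_nonneg _) _)
      (Set.Ioc_subset_Ioc_right hbT).eventuallyLE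
  have hroot : (∫ τ in Set.Ioc a b, |h τ| ^ r) ^ (1 / r) ≤ Ch := by
    calc (∫ τ in Set.Ioc a b, |h τ| ^ r) ^ (1 / r) ≤ (Ch ^ r) ^ (1 / r) := by
          refine Real.rpow_le_rpow (integral_nonneg fun _ => ?_) hmono (by positivity)
          exact Real.rpow_nonneg (abs_nonneg _) _
      _ = Ch := by rw [one_div, Real.rpow_rpow_inv hCh.le hr0.ne']
  have hexp : 1 / Real.conjExponent r = (r - 1) / r := by
    rw [Real.conjExponent, one_div_div]
  rw [intervalIntegral.integral_of_le hab]
  simp only [mul_one, Real.one_rpow, integral_const, smul_eq_mul, hexp,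
    measureReal_restrict_apply_univ, Real.volume_real_Ioc_of_le hab] at holder
  exact holder.trans (mul_le_mul_of_nonneg_right hroot
    (Real.rpow_nonneg (sub_nonneg.2 hab) _))

lemma integral_abs_le_nat_mul {T Ch r : ℝ} (hT : 0 < T) (hCh : 0 < Ch) (hr : 1 < r)
    {h : ℝ → ℝ} (hmeas : Measurable h)
    (hloc : ∀ a b : ℝ, 0 ≤ a → IntegrableOn (fun τ => |h τ| ^ r) (Set.Icc a b))
    (hbound : ∀ s : ℝ, 0 ≤ s → (∫ τ in s..(s + T), |h τ| ^ r) ≤ Ch ^ r)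
    {s : ℝ} (hs : 0 ≤ s) (n : ℕ) :
    (∫ τ in s..(s + n * T), |h τ|) ≤ n * (Ch * T ^ ((r - 1) / r)) := by
  induction n with
  | zero => simp
  | succ n ih =>
    have hn : 0 ≤ n * T := by positivity
    have hstep : s + (n + 1 : ℕ) * T = s + n * T + T := by push_cast; ring
    have hlast := integral_abs_le_of_length_le hCh hr hmeas hloc hbound
      (a := s + n * T) (b := s + n * T + T) (by linarith) (by linarith) le_rfl
    rw [add_sub_cancel_left] at hlast
    rw [hstep, ← intervalIntegral.integral_add_adjacent_intervals
      (intervalIntegrable_abs_of_rpow hr hmeas hloc hs (by linarith : s ≤ s + n * T))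
      (intervalIntegrable_abs_of_rpow hr hmeas hloc (by linarith) (by linarith))]
    push_cast
    linarith

/-- For `T > 0`, `C_h > 0`, `r > 1`, and a measurable `h : ℝ → ℝ` with `|h|^r` locally
integrable on `[0,∞)` and `∫_s^{s+T} |h|^r ≤ C_h^r` for every `s ≥ 0`, one has, for all
`t ≥ s ≥ 0`, `∫_s^t |h| ≤ T^(-1/r) C_h (t-s) + C_h (t-s)^((r-1)/r)`. -/
theorem stmt_1 (T Ch r : ℝ) (hT : 0 < T) (hCh : 0 < Ch) (hr : 1 < r)
    (h : ℝ → ℝ) (hmeas : Measurable h)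
    (hloc : ∀ a b : ℝ, 0 ≤ a → IntegrableOn (fun τ => |h τ| ^ r) (Set.Icc a b))
    (hbound : ∀ s : ℝ, 0 ≤ s → (∫ τ in s..(s + T), |h τ| ^ r) ≤ Ch ^ r) :
    ∀ s t : ℝ, 0 ≤ s → s ≤ t →
      (∫ τ in s..t, |h τ|) ≤ T ^ (-1 / r) * Ch * (t - s) + Ch * (t - s) ^ ((r - 1) / r) := by
  intro s t hs hst
  have hr0 : 0 < r := by linarith
  set n := ⌊(t - s) / T⌋₊
  have hn0 : 0 ≤ n * T := by positivity
  have hn : n * T ≤ t - s :=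
    (le_div_iff₀ hT).1 (Nat.floor_le (div_nonneg (sub_nonneg.2 hst) hT.le))
  have hn' : t - s < (n + 1) * T := (div_lt_iff₀ hT).1 (Nat.lt_floor_add_one _)
  have hmain := integral_abs_le_nat_mul hT hCh hr hmeas hloc hbound hs n
  have hrem := integral_abs_le_of_length_le hCh hr hmeas hloc hbound
    (a := s + n * T) (b := t) (by linarith) (by linarith) (by linarith)
  have hTpow : T ^ ((r - 1) / r) = T ^ (-1 / r) * T := by
    rw [← Real.rpow_add_one hT.ne']
    congr 1
    field_simp
    ring
  have hlin : n * (Ch * T ^ ((r - 1) / r)) ≤ T ^ (-1 / r) * Ch * (t - s) := by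
    calc n * (Ch * T ^ ((r - 1) / r)) = T ^ (-1 / r) * Ch * (n * T) := by rw [hTpow]; ring
      _ ≤ T ^ (-1 / r) * Ch * (t - s) := by gcongr
  have hpow : Ch * (t - (s + n * T)) ^ ((r - 1) / r) ≤ Ch * (t - s) ^ ((r - 1) / r) := by
    refine mul_le_mul_of_nonneg_left (Real.rpow_le_rpow ?_ ?_ ?_) hCh.le
    · linarith
    · linarith
    · exact div_nonneg (by linarith) hr0.le
  rw [← intervalIntegral.integral_add_adjacent_intervals
    (intervalIntegrable_abs_of_rpow hr hmeas hloc hs (by linarith : s ≤ s + n * T))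
    (intervalIntegrable_abs_of_rpow hr hmeas hloc (by linarith) (by linarith))]
  linarith
end

section
/- Let μ₀ > 0 and p > 0 be real numbers. Then for every t ≥ 0 one has ∫_0^t e^{−2μ₀(t−τ)}·e^{−(p+1)μ₀τ}·|h(τ)| dτ ≤ C_h·(1 − e^{−𝔯μ₀pT})^{−1/𝔯}·((𝔯−1)/(𝔯μ₀))^{(𝔯−1)/𝔯}·e^{−μ₀t}. -/
open MeasureTheory

/-- A nonnegative function whose integrals over windows of length `T` are at most `M` has
exponentially weighted integrals bounded by the corresponding geometric series. -/
theorem integral_exp_mul_le_of_window_bound {g : ℝ → ℝ} {T M a : ℝ} (hT : 0 < T) (ha : 0 < a)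
    (hg : ∀ x, 0 ≤ g x) (hloc : ∀ b c : ℝ, 0 ≤ b → IntegrableOn g (Set.Icc b c))
    (hbound : ∀ s : ℝ, 0 ≤ s → (∫ τ in s..(s + T), g τ) ≤ M) {t : ℝ} (ht : 0 ≤ t) :
    ∫ τ in (0:ℝ)..t, Real.exp (-a * τ) * g τ ≤ M * (1 - Real.exp (-a * T))⁻¹ := by
  have hint : ∀ b c : ℝ, 0 ≤ b → b ≤ c → IntervalIntegrable g volume b c := fun b c hb hbc =>
    (intervalIntegrable_iff_integrableOn_Icc_of_le hbc).2 (hloc b c hb)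
  have hint' : ∀ b c : ℝ, 0 ≤ b → b ≤ c →
      IntervalIntegrable (fun τ => Real.exp (-a * τ) * g τ) volume b c := fun b c hb hbc =>
    (hint b c hb hbc).continuousOn_mul (by fun_prop)
  have hM : 0 ≤ M :=
    (intervalIntegral.integral_nonneg (by linarith) fun x _ => hg x).trans (hbound 0 le_rfl)
  set x := Real.exp (-a * T) with hx
  have hx0 : 0 ≤ x := (Real.exp_pos _).le
  have hx1 : x < 1 := by
    rw [hx, Real.exp_lt_one_iff]
    nlinarith
  have key : ∀ n : ℕ, ∫ τ in (0:ℝ)..(n * T), Real.exp (-a * τ) * g τ ≤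
      M * ∑ k ∈ Finset.range n, x ^ k := by
    intro n
    induction n with
    | zero => simp
    | succ n ih =>
      have hn : (0:ℝ) ≤ n * T := by positivity
      have hle : (n:ℝ) * T ≤ n * T + T := by linarith
      have hsplit : ((n + 1 : ℕ) : ℝ) * T = n * T + T := by push_cast; ring
      rw [hsplit, ← intervalIntegral.integral_add_adjacent_intervals
        (hint' 0 _ le_rfl hn) (hint' _ _ hn hle), Finset.sum_range_succ, mul_add]
      refine add_le_add ih ?_
      calc ∫ τ in (n * T : ℝ)..(n * T + T), Real.exp (-a * τ) * g τ
          ≤ ∫ τ in (n * T : ℝ)..(n * T + T), x ^ n * g τ := by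
            refine intervalIntegral.integral_mono_on hle (hint' _ _ hn hle)
              ((hint _ _ hn hle).const_mul _) fun τ hτ => ?_
            refine mul_le_mul_of_nonneg_right ?_ (hg τ)
            rw [hx, ← Real.exp_nat_mul]
            refine Real.exp_le_exp.2 ?_
            nlinarith [hτ.1]
        _ = x ^ n * ∫ τ in (n * T : ℝ)..(n * T + T), g τ :=
            intervalIntegral.integral_const_mul _ _
        _ ≤ x ^ n * M := mul_le_mul_of_nonneg_left (hbound _ hn) (by positivity)
        _ = M * x ^ n := mul_comm _ _
  obtain ⟨n, hn⟩ := exists_nat_ge (t / T)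
  have htn : t ≤ n * T := (div_le_iff₀ hT).1 hn
  calc ∫ τ in (0:ℝ)..t, Real.exp (-a * τ) * g τ
      ≤ ∫ τ in (0:ℝ)..(n * T), Real.exp (-a * τ) * g τ :=
        intervalIntegral.integral_mono_interval le_rfl ht htn
          (Filter.Eventually.of_forall fun τ => mul_nonneg (Real.exp_pos _).le (hg τ))
          (hint' _ _ le_rfl (ht.trans htn))
    _ ≤ M * ∑ k ∈ Finset.range n, x ^ k := key n
    _ ≤ M * (1 - x)⁻¹ := by
        refine mul_le_mul_of_nonneg_left ?_ hM
        rw [← tsum_geometric_of_lt_one hx0 hx1]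
        exact (summable_geometric_of_lt_one hx0 hx1).sum_le_tsum _ fun k _ => by positivity

/-- The `q`-th power of `τ ↦ exp (-2 * m * t + m * τ)` has integral at most
`exp (-m * t) ^ q / (q * m)` over `[0, t]`. -/
theorem integral_exp_rpow_le {m q : ℝ} (hm : 0 < m) (hq : 0 < q) (t : ℝ) :
    ∫ τ in (0:ℝ)..t, Real.exp (-2 * m * t + m * τ) ^ q ≤
      (q * m)⁻¹ * Real.exp (-m * t) ^ q := by
  have hderiv : ∀ τ ∈ Set.uIcc 0 t, HasDerivAt
      (fun τ => (q * m)⁻¹ * Real.exp ((-2 * m * t + m * τ) * q))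
      (Real.exp ((-2 * m * t + m * τ) * q)) τ := by
    intro τ _
    have h1 : HasDerivAt (fun τ => (-2 * m * t + m * τ) * q) (m * 1 * q) τ :=
      (((hasDerivAt_id τ).const_mul m).const_add _).mul_const q
    have h2 := h1.exp.const_mul (q * m)⁻¹
    rwa [show (q * m)⁻¹ * (Real.exp ((-2 * m * t + m * τ) * q) * (m * 1 * q)) =
      Real.exp ((-2 * m * t + m * τ) * q) by field_simp] at h2
  simp_rw [← Real.exp_mul]
  rw [intervalIntegral.integral_eq_sub_of_hasDerivAt hderiv
    (Continuous.intervalIntegrable (by fun_prop) _ _)]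
  have h2 : (-2 * m * t + m * t) * q = -m * t * q := by ring
  rw [h2]
  have : 0 ≤ (q * m)⁻¹ * Real.exp ((-2 * m * t + m * 0) * q) := by positivity
  linarith

/-- For `μ₀ > 0` and `p > 0`, for every `t ≥ 0`,
`∫_0^t e^{-2μ₀(t-τ)} e^{-(p+1)μ₀ τ} |h(τ)| dτ
  ≤ C_h (1 - e^{-r μ₀ p T})^(-1/r) ((r-1)/(r μ₀))^((r-1)/r) e^{-μ₀ t}`. -/
theorem stmt_4 (T Ch r : ℝ) (hT : 0 < T) (hCh : 0 < Ch) (hr : 1 < r)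
    (h : ℝ → ℝ) (hmeas : Measurable h)
    (hloc : ∀ a b : ℝ, 0 ≤ a → IntegrableOn (fun τ => |h τ| ^ r) (Set.Icc a b))
    (hbound : ∀ s : ℝ, 0 ≤ s → (∫ τ in s..(s + T), |h τ| ^ r) ≤ Ch ^ r)
    (μ₀ p : ℝ) (hμ₀ : 0 < μ₀) (hp : 0 < p) :
    ∀ t : ℝ, 0 ≤ t →
      (∫ τ in (0:ℝ)..t, Real.exp (-2 * μ₀ * (t - τ)) * Real.exp (-(p + 1) * μ₀ * τ) * |h τ|) ≤
        Ch * (1 - Real.exp (-r * μ₀ * p * T)) ^ (-1 / r) *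
          ((r - 1) / (r * μ₀)) ^ ((r - 1) / r) * Real.exp (-μ₀ * t) := by
  intro t ht
  have hr0 : 0 < r := by linarith
  have hr1 : 0 < r - 1 := by linarith
  set q := r / (r - 1) with hq
  have hq0 : 0 < q := div_pos hr0 hr1
  have hconj : q.HolderConjugate r := (Real.HolderConjugate.conjExponent hr).symm
  set f : ℝ → ℝ := fun τ => Real.exp (-2 * μ₀ * t + μ₀ * τ) with hf
  set k : ℝ → ℝ := fun τ => Real.exp (-(μ₀ * p) * τ) * |h τ| with hk
  have hk0 : ∀ τ, 0 ≤ k τ := fun τ => mul_nonneg (Real.exp_pos _).le (abs_nonneg _)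
  have hkr : ∀ τ, k τ ^ r = Real.exp (-(r * μ₀ * p) * τ) * |h τ| ^ r := by
    intro τ
    rw [hk, Real.mul_rpow (Real.exp_pos _).le (abs_nonneg _), ← Real.exp_mul]
    congr 2
    ring
  have hsplit : ∀ τ, Real.exp (-2 * μ₀ * (t - τ)) * Real.exp (-(p + 1) * μ₀ * τ) * |h τ| =
      f τ * k τ := by
    intro τ
    rw [hf, hk, ← mul_assoc, ← Real.exp_add, ← Real.exp_add]
    congr 2
    ring
  have hfmem : MemLp f (ENNReal.ofReal q) (volume.restrict (Set.Ioc 0 t)) := by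
    have hfc : Continuous f := by fun_prop
    rw [← integrable_norm_rpow_iff hfc.aestronglyMeasurable (by simpa using hq0)
      ENNReal.ofReal_ne_top, ENNReal.toReal_ofReal hq0.le]
    exact ((hfc.norm.rpow_const fun _ => Or.inr hq0.le).integrableOn_Icc (a := 0) (b := t)).mono_set
      Set.Ioc_subset_Icc_self
  have hkmem : MemLp k (ENNReal.ofReal r) (volume.restrict (Set.Ioc 0 t)) := by
    have hkm : Measurable k := by fun_prop
    rw [← integrable_norm_rpow_iff hkm.aestronglyMeasurable (by simpa using hr0)
      ENNReal.ofReal_ne_top, ENNReal.toReal_ofReal hr0.le]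
    simp_rw [Real.norm_of_nonneg (hk0 _), hkr]
    exact ((hloc 0 t le_rfl).continuousOn_mul (by fun_prop) isCompact_Icc).mono_set
      Set.Ioc_subset_Icc_self
  have hholder := integral_mul_le_Lp_mul_Lq_of_nonneg hconj
    (Filter.Eventually.of_forall fun τ => (Real.exp_pos _).le)
    (Filter.Eventually.of_forall hk0) hfmem hkmem
  rw [← intervalIntegral.integral_of_le ht, ← intervalIntegral.integral_of_le ht,
    ← intervalIntegral.integral_of_le ht] at hholder
  simp_rw [hsplit]
  have hfint : ∫ τ in (0:ℝ)..t, f τ ^ q ≤ (q * μ₀)⁻¹ * Real.exp (-μ₀ * t) ^ q :=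
    integral_exp_rpow_le hμ₀ hq0 t
  have hkint : ∫ τ in (0:ℝ)..t, k τ ^ r ≤ Ch ^ r * (1 - Real.exp (-r * μ₀ * p * T))⁻¹ := by
    simp_rw [hkr]
    have := integral_exp_mul_le_of_window_bound hT (a := r * μ₀ * p) (by positivity)
      (fun x => Real.rpow_nonneg (abs_nonneg (h x)) r) hloc hbound ht
    simpa only [neg_mul] using this
  have hD : 0 ≤ 1 - Real.exp (-r * μ₀ * p * T) := by
    have : 0 < r * μ₀ * p * T := by positivity
    rw [sub_nonneg, Real.exp_le_one_iff]
    linarith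
  have hA : ((q * μ₀)⁻¹ * Real.exp (-μ₀ * t) ^ q) ^ (1 / q) =
      ((r - 1) / (r * μ₀)) ^ ((r - 1) / r) * Real.exp (-μ₀ * t) := by
    rw [Real.mul_rpow (by positivity) (by positivity), one_div,
      Real.rpow_rpow_inv (Real.exp_pos _).le hq0.ne', hq, inv_div]
    congr 2
    field_simp
  have hB : (Ch ^ r * (1 - Real.exp (-r * μ₀ * p * T))⁻¹) ^ (1 / r) =
      Ch * (1 - Real.exp (-r * μ₀ * p * T)) ^ (-1 / r) := by
    rw [Real.mul_rpow (by positivity) (inv_nonneg.2 hD), one_div,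
      Real.rpow_rpow_inv hCh.le hr0.ne', Real.inv_rpow hD, ← Real.rpow_neg hD, neg_div, one_div]
  calc ∫ τ in (0:ℝ)..t, f τ * k τ
      ≤ (∫ τ in (0:ℝ)..t, f τ ^ q) ^ (1 / q) * (∫ τ in (0:ℝ)..t, k τ ^ r) ^ (1 / r) := hholder
    _ ≤ ((q * μ₀)⁻¹ * Real.exp (-μ₀ * t) ^ q) ^ (1 / q) *
        (Ch ^ r * (1 - Real.exp (-r * μ₀ * p * T))⁻¹) ^ (1 / r) := by
        have hf0 : 0 ≤ ∫ τ in (0:ℝ)..t, f τ ^ q :=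
          intervalIntegral.integral_nonneg ht fun τ _ => by positivity
        have hk0' : 0 ≤ ∫ τ in (0:ℝ)..t, k τ ^ r :=
          intervalIntegral.integral_nonneg ht fun τ _ => Real.rpow_nonneg (hk0 τ) r
        gcongr
    _ = _ := by
        rw [hA, hB]
        ring
end

section
/- Let ϖ₀ ∈ ℝ with |ϖ₀| ≤ ρ·R and let ϖ̆ : [0,∞) → ℝ be measurable with |ϖ̆(t)| ≤ ρ·e^{−μ₀t}·|ϖ₀| for all t ≥ 0. Define ϖ(t) := S(t,0)·ϖ₀ + ∫_0^t S(t,τ)·|h(τ)|·|ϖ̆(τ)|^p·ϖ̆(τ) dτ for t ≥ 0. Then |ϖ(t)| ≤ ρ·e^{−μ₀t}·|ϖ₀| for all t ≥ 0. -/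
open MeasureTheory

/-- The tangent-line form of Young's inequality. -/
theorem le_linear_add_rpow {r x m : ℝ} (hr : 1 < r) (hx : 0 ≤ x) (hm : 0 < m) :
    x ≤ (r - 1) / r * m + x ^ r * (m ^ (1 - r) / r) := by
  have hb := one_add_mul_self_le_rpow_one_add (s := x / m - 1)
    (by have := div_nonneg hx hm.le; linarith) hr.le
  rw [add_sub_cancel, Real.div_rpow hx hm.le] at hb
  rw [Real.rpow_sub hm, Real.rpow_one]
  have hmr : 0 < m ^ r := Real.rpow_pos_of_pos hm r
  have h0 : 0 < r := by linarith
  have hb2 := mul_le_mul_of_nonneg_left hb (div_pos hm h0).le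
  have e1 : m / r * (1 + r * (x / m - 1)) = x - (r - 1) / r * m := by
    field_simp; ring
  have e2 : m / r * (x ^ r / m ^ r) = x ^ r * (m / m ^ r / r) := by
    field_simp
  linarith

/-- Young's inequality for a product, with one factor an exponential. -/
theorem exp_mul_le_add_rpow {r y m u : ℝ} (hr : 1 < r) (hy : 0 ≤ y) (hm : 0 < m) :
    Real.exp u * y ≤
      (r - 1) / r * m * Real.exp (r / (r - 1) * u) + y ^ r * (m ^ (1 - r) / r) := by
  have h1 : 0 < r - 1 := by linarith
  have hE := Real.exp_pos (1 / (r - 1) * u)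
  have key := le_linear_add_rpow hr hy (mul_pos hm hE)
  have key2 := mul_le_mul_of_nonneg_left key (Real.exp_pos u).le
  rw [Real.mul_rpow hm.le hE.le, ← Real.exp_mul] at key2
  have e1 : Real.exp (r / (r - 1) * u) = Real.exp u * Real.exp (1 / (r - 1) * u) := by
    rw [← Real.exp_add]; congr 1; field_simp; ring
  have e2 : Real.exp u * Real.exp (1 / (r - 1) * u * (1 - r)) = 1 := by
    rw [← Real.exp_add, Real.exp_eq_one_iff]; field_simp; ring
  rw [e1]
  calc _ ≤ _ := key2
    _ = (r - 1) / r * m * (Real.exp u * Real.exp (1 / (r - 1) * u)) +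
        (Real.exp u * Real.exp (1 / (r - 1) * u * (1 - r))) * (y ^ r * (m ^ (1 - r) / r)) := by
      ring
    _ = _ := by rw [e2, one_mul]

section WindowBounds

variable {T Ch r : ℝ} {h : ℝ → ℝ}

theorem intervalIntegrable_abs_rpow
    (hloc : ∀ a b : ℝ, 0 ≤ a → IntegrableOn (fun τ => |h τ| ^ r) (Set.Icc a b))
    {a b : ℝ} (ha : 0 ≤ a) (hab : a ≤ b) :
    IntervalIntegrable (fun τ => |h τ| ^ r) volume a b :=
  (intervalIntegrable_iff_integrableOn_Icc_of_le hab).2 (hloc a b ha)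

theorem intervalIntegrable_abs (hr : 1 < r) (hmeas : Measurable h)
    (hloc : ∀ a b : ℝ, 0 ≤ a → IntegrableOn (fun τ => |h τ| ^ r) (Set.Icc a b))
    {a b : ℝ} (ha : 0 ≤ a) (hab : a ≤ b) :
    IntervalIntegrable (fun τ => |h τ|) volume a b := by
  have hg : IntervalIntegrable
      (fun τ => (r - 1) / r * 1 + |h τ| ^ r * ((1 : ℝ) ^ (1 - r) / r)) volume a b :=
    intervalIntegrable_const.add ((intervalIntegrable_abs_rpow hloc ha hab).mul_const _)
  refine hg.mono_fun' (by fun_prop) (Filter.Eventually.of_forall fun τ => ?_)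
  simpa using le_linear_add_rpow hr (abs_nonneg (h τ)) one_pos

theorem integral_abs_le_of_le_window (hr : 1 < r) (hmeas : Measurable h)
    (hloc : ∀ a b : ℝ, 0 ≤ a → IntegrableOn (fun τ => |h τ| ^ r) (Set.Icc a b))
    (hbound : ∀ s : ℝ, 0 ≤ s → (∫ τ in s..(s + T), |h τ| ^ r) ≤ Ch ^ r)
    {m s t : ℝ} (hm : 0 < m) (hs : 0 ≤ s) (hst : s ≤ t) (htT : t ≤ s + T) :
    ∫ τ in s..t, |h τ| ≤ (r - 1) / r * m * (t - s) + Ch ^ r * (m ^ (1 - r) / r) := by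
  have hi := intervalIntegrable_abs_rpow hloc hs hst
  have h1 : ∫ τ in s..t, |h τ| ^ r ≤ Ch ^ r := by
    refine le_trans ?_ (hbound s hs)
    exact intervalIntegral.integral_mono_interval le_rfl hst htT
      (Filter.Eventually.of_forall fun τ => Real.rpow_nonneg (abs_nonneg _) _)
      (intervalIntegrable_abs_rpow hloc hs (hst.trans htT))
  calc ∫ τ in s..t, |h τ|
      ≤ ∫ τ in s..t, ((r - 1) / r * m + |h τ| ^ r * (m ^ (1 - r) / r)) :=
        intervalIntegral.integral_mono_on hst (intervalIntegrable_abs hr hmeas hloc hs hst)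
          (intervalIntegrable_const.add (hi.mul_const _))
          fun τ _ => le_linear_add_rpow hr (abs_nonneg _) hm
    _ = (r - 1) / r * m * (t - s) + (∫ τ in s..t, |h τ| ^ r) * (m ^ (1 - r) / r) := by
        rw [intervalIntegral.integral_add intervalIntegrable_const (hi.mul_const _),
          intervalIntegral.integral_const, intervalIntegral.integral_mul_const, smul_eq_mul]
        ring
    _ ≤ _ := by
        have : 0 ≤ m ^ (1 - r) / r := by positivity
        gcongr

theorem integral_abs_le_window (hT : 0 < T) (hCh : 0 < Ch) (hr : 1 < r) (hmeas : Measurable h)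
    (hloc : ∀ a b : ℝ, 0 ≤ a → IntegrableOn (fun τ => |h τ| ^ r) (Set.Icc a b))
    (hbound : ∀ s : ℝ, 0 ≤ s → (∫ τ in s..(s + T), |h τ| ^ r) ≤ Ch ^ r)
    {s : ℝ} (hs : 0 ≤ s) :
    ∫ τ in s..(s + T), |h τ| ≤ T ^ (-1 / r) * Ch * T := by
  have h0 : 0 < r := by linarith
  have hm : 0 < T ^ (-1 / r) * Ch := by positivity
  have key := integral_abs_le_of_le_window hr hmeas hloc hbound hm hs
    (by linarith : s ≤ s + T) le_rfl
  refine key.trans (le_of_eq ?_)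
  have e : Ch ^ r * (T ^ (-1 / r) * Ch) ^ (1 - r) = T ^ (-1 / r) * Ch * T := by
    rw [Real.mul_rpow (by positivity) hCh.le, ← Real.rpow_mul hT.le]
    have e1 : Ch ^ r * Ch ^ (1 - r) = Ch := by
      rw [← Real.rpow_add hCh, add_sub_cancel, Real.rpow_one]
    have e2 : T ^ (-1 / r * (1 - r)) = T ^ (-1 / r) * T := by
      rw [← Real.rpow_add_one hT.ne']; congr 1; field_simp; ring
    rw [e2, mul_left_comm, e1]; ring
  rw [← mul_div_assoc, e]
  field_simp; ring

theorem integral_abs_le_linear (hT : 0 < T) (hCh : 0 < Ch) (hr : 1 < r) (hmeas : Measurable h)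
    (hloc : ∀ a b : ℝ, 0 ≤ a → IntegrableOn (fun τ => |h τ| ^ r) (Set.Icc a b))
    (hbound : ∀ s : ℝ, 0 ≤ s → (∫ τ in s..(s + T), |h τ| ^ r) ≤ Ch ^ r)
    {m : ℝ} (hm : 0 < m) {s t : ℝ} (hs : 0 ≤ s) (hst : s ≤ t) :
    ∫ τ in s..t, |h τ| ≤
      (T ^ (-1 / r) * Ch + (r - 1) / r * m) * (t - s) + Ch ^ r * (m ^ (1 - r) / r) := by
  have h0 : 0 < r := by linarith
  have hH : 0 < T ^ (-1 / r) * Ch := by positivity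
  have hb : 0 ≤ (r - 1) / r * m :=
    mul_nonneg (div_nonneg (by linarith) h0.le) hm.le
  have main : ∀ n : ℕ, ∀ s : ℝ, 0 ≤ s → s ≤ t → t ≤ s + (n + 1) * T →
      ∫ τ in s..t, |h τ| ≤
        (T ^ (-1 / r) * Ch + (r - 1) / r * m) * (t - s) + Ch ^ r * (m ^ (1 - r) / r) := by
    intro n
    induction n with
    | zero =>
      intro s hs hst ht
      have := integral_abs_le_of_le_window hr hmeas hloc hbound hm hs hst (by simpa using ht)
      nlinarith [mul_nonneg hH.le (sub_nonneg.2 hst)]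
    | succ n ih =>
      intro s hs hst ht
      push_cast at ht
      rcases le_total t (s + T) with hc | hc
      · have := integral_abs_le_of_le_window hr hmeas hloc hbound hm hs hst hc
        nlinarith [mul_nonneg hH.le (sub_nonneg.2 hst)]
      · have h1 := integral_abs_le_window hT hCh hr hmeas hloc hbound hs
        have h2 := ih (s + T) (by linarith) hc (by linarith)
        rw [← intervalIntegral.integral_add_adjacent_intervals
          (intervalIntegrable_abs hr hmeas hloc hs (by linarith : s ≤ s + T))
          (intervalIntegrable_abs hr hmeas hloc (by linarith) hc)]
        nlinarith [mul_nonneg hb hT.le]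
  obtain ⟨n, hn⟩ := exists_nat_ge ((t - s) / T)
  rw [div_le_iff₀ hT] at hn
  exact main n s hs hst (by linarith)

theorem integral_exp_mul_abs_rpow_le (hT : 0 < T) (hCh : 0 < Ch)
    (hloc : ∀ a b : ℝ, 0 ≤ a → IntegrableOn (fun τ => |h τ| ^ r) (Set.Icc a b))
    (hbound : ∀ s : ℝ, 0 ≤ s → (∫ τ in s..(s + T), |h τ| ^ r) ≤ Ch ^ r)
    {k : ℝ} (hk : Real.log 2 ≤ k * T) {t : ℝ} (ht : 0 ≤ t) :
    ∫ τ in (0 : ℝ)..t, Real.exp (-k * τ) * |h τ| ^ r ≤ 2 * Ch ^ r := by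
  have hk0 : 0 < k := by
    have : 0 < k * T := (Real.log_pos one_lt_two).trans_le hk
    exact pos_of_mul_pos_left this hT.le
  have hii : ∀ {a b : ℝ}, 0 ≤ a → a ≤ b →
      IntervalIntegrable (fun τ => Real.exp (-k * τ) * |h τ| ^ r) volume a b := fun ha hab =>
    (intervalIntegrable_abs_rpow hloc ha hab).continuousOn_mul (by fun_prop)
  have hC : 0 < Ch ^ r := by positivity
  have main : ∀ n : ℕ, ∫ τ in (0 : ℝ)..(n * T), Real.exp (-k * τ) * |h τ| ^ r ≤
      2 * Ch ^ r * (1 - (1 / 2) ^ n) := by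
    intro n
    induction n with
    | zero => simp
    | succ n ih =>
      have hn : (0 : ℝ) ≤ n * T := by positivity
      have hle : (n : ℝ) * T ≤ n * T + T := by linarith
      have hexp : Real.exp (-k * (n * T)) ≤ (1 / 2) ^ n := by
        have : Real.exp (-(k * T)) ≤ 1 / 2 := by
          rw [Real.exp_neg, one_div]
          exact inv_anti₀ two_pos ((Real.log_le_iff_le_exp two_pos).1 hk)
        calc Real.exp (-k * (n * T)) = Real.exp (-(k * T)) ^ n := by
              rw [← Real.exp_nat_mul]; congr 1; ring
          _ ≤ _ := by gcongr
      have hw : ∫ τ in (n * T : ℝ)..(n * T + T), Real.exp (-k * τ) * |h τ| ^ r ≤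
          (1 / 2) ^ n * Ch ^ r := by
        calc _ ≤ ∫ τ in (n * T : ℝ)..(n * T + T), (1 / 2) ^ n * |h τ| ^ r := by
              refine intervalIntegral.integral_mono_on hle (hii hn hle)
                ((intervalIntegrable_abs_rpow hloc hn hle).const_mul _) fun τ hτ => ?_
              have : Real.exp (-k * τ) ≤ Real.exp (-k * (n * T)) :=
                Real.exp_le_exp.2 (by nlinarith [hτ.1])
              exact mul_le_mul_of_nonneg_right (this.trans hexp)
                (Real.rpow_nonneg (abs_nonneg _) _)
          _ ≤ _ := by
              rw [intervalIntegral.integral_const_mul]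
              exact mul_le_mul_of_nonneg_left (hbound _ hn) (by positivity)
      have e : ((n + 1 : ℕ) : ℝ) * T = n * T + T := by push_cast; ring
      rw [e, ← intervalIntegral.integral_add_adjacent_intervals (hii le_rfl hn) (hii hn hle),
        pow_succ]
      nlinarith
  obtain ⟨n, hn⟩ := exists_nat_ge (t / T)
  rw [div_le_iff₀ hT] at hn
  calc _ ≤ ∫ τ in (0 : ℝ)..(n * T), Real.exp (-k * τ) * |h τ| ^ r :=
        intervalIntegral.integral_mono_interval le_rfl ht hn
          (Filter.Eventually.of_forall fun τ => by positivity) (hii le_rfl (ht.trans hn))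
    _ ≤ _ := main n
    _ ≤ _ := by
        have : (0 : ℝ) ≤ (1 / 2) ^ n := by positivity
        nlinarith

theorem integral_exp_neg_mul_sub_le {k : ℝ} (hk : 0 < k) (t : ℝ) :
    ∫ τ in (0 : ℝ)..t, Real.exp (-k * (t - τ)) ≤ 1 / k := by
  have hd : ∀ τ ∈ Set.uIcc 0 t, HasDerivAt (fun τ => Real.exp (-k * (t - τ)) / k)
      (Real.exp (-k * (t - τ))) τ := by
    intro τ _
    have h1 : HasDerivAt (fun τ => -k * (t - τ)) (-k * (-1)) τ :=
      ((hasDerivAt_id τ).const_sub t).const_mul (-k)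
    have h2 := h1.exp.div_const k
    rwa [neg_mul_neg, mul_one, mul_div_cancel_right₀ _ hk.ne'] at h2
  rw [intervalIntegral.integral_eq_sub_of_hasDerivAt hd
    (Continuous.intervalIntegrable (by fun_prop) _ _)]
  have : 0 < Real.exp (-k * (t - 0)) / k := by positivity
  simp only [sub_self, mul_zero, Real.exp_zero]
  linarith

/-- Integral of the Young majorant of `exp (-μ₀ (t - τ)) * (B * exp (-p μ₀ τ) * |h τ|)`. -/
theorem integral_young_majorant_le (hT : 0 < T) (hCh : 0 < Ch) (hr : 1 < r)
    (hloc : ∀ a b : ℝ, 0 ≤ a → IntegrableOn (fun τ => |h τ| ^ r) (Set.Icc a b))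
    (hbound : ∀ s : ℝ, 0 ≤ s → (∫ τ in s..(s + T), |h τ| ^ r) ≤ Ch ^ r)
    {p μ₀ B : ℝ} (hp : 0 < p) (hB : 0 < B) (hμ₀ : 0 < μ₀) (hlog : Real.log 2 ≤ p * μ₀ * T)
    (hBμ : (B * Ch) ^ (r / (r - 1)) * ((r - 1) / r) * 2 ^ (1 / (r - 1)) ≤ μ₀)
    {t : ℝ} (ht : 0 ≤ t) :
    let m := r / (r - 1) * μ₀
    let g := fun τ => (r - 1) / r * m * Real.exp (r / (r - 1) * (-μ₀ * (t - τ))) +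
      (B * Real.exp (-(p * μ₀) * τ) * |h τ|) ^ r * (m ^ (1 - r) / r)
    IntervalIntegrable g volume 0 t ∧ ∫ τ in (0 : ℝ)..t, g τ ≤ 1 := by
  intro m g
  have h0 : 0 < r := by linarith
  have h1 : 0 < r - 1 := by linarith
  have hm : 0 < m := by positivity
  have hkk : Real.log 2 ≤ r * (p * μ₀) * T := by
    have : 0 ≤ p * μ₀ * T := by positivity
    nlinarith
  have hg : g = fun τ => (r - 1) / r * m * Real.exp (-m * (t - τ)) +
      (B ^ r * (m ^ (1 - r) / r)) * (Real.exp (-(r * (p * μ₀)) * τ) * |h τ| ^ r) := by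
    funext τ
    simp only [g, m]
    rw [Real.mul_rpow (by positivity) (abs_nonneg _), Real.mul_rpow hB.le (by positivity),
      ← Real.exp_mul]
    have e1 : r / (r - 1) * (-μ₀ * (t - τ)) = -(r / (r - 1) * μ₀) * (t - τ) := by ring
    have e2 : -(p * μ₀) * τ * r = -(r * (p * μ₀)) * τ := by ring
    rw [e1, e2]; ring
  have i1 : IntervalIntegrable (fun τ => (r - 1) / r * m * Real.exp (-m * (t - τ)))
      volume 0 t := Continuous.intervalIntegrable (by fun_prop) _ _
  have i2 : IntervalIntegrable (fun τ => (B ^ r * (m ^ (1 - r) / r)) *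
      (Real.exp (-(r * (p * μ₀)) * τ) * |h τ| ^ r)) volume 0 t :=
    ((intervalIntegrable_abs_rpow hloc le_rfl ht).continuousOn_mul (by fun_prop)).const_mul _
  have hpow : 2 * (B * Ch) ^ r ≤ m ^ (r - 1) := by
    have hle : (B * Ch) ^ (r / (r - 1)) * 2 ^ (1 / (r - 1)) ≤ m := by
      have := mul_le_mul_of_nonneg_left hBμ (by positivity : 0 ≤ r / (r - 1))
      refine le_trans (le_of_eq ?_) this
      field_simp
    have := Real.rpow_le_rpow (by positivity) hle h1.le
    rwa [Real.mul_rpow (by positivity) (by positivity), ← Real.rpow_mul (by positivity),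
      ← Real.rpow_mul (by positivity), div_mul_cancel₀ _ h1.ne', div_mul_cancel₀ _ h1.ne',
      Real.rpow_one, mul_comm] at this
  have hsecond : B ^ r * m ^ (1 - r) * (2 * Ch ^ r) ≤ 1 := by
    rw [Real.mul_rpow hB.le hCh.le] at hpow
    have e : m ^ (1 - r) * m ^ (r - 1) = 1 := by
      rw [← Real.rpow_add hm]; simp
    have := mul_le_mul_of_nonneg_left hpow (Real.rpow_nonneg hm.le (1 - r))
    rw [e] at this
    linarith
  rw [hg]
  refine ⟨i1.add i2, ?_⟩
  rw [intervalIntegral.integral_add i1 i2, intervalIntegral.integral_const_mul,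
    intervalIntegral.integral_const_mul]
  calc _ ≤ (r - 1) / r * m * (1 / m) + B ^ r * (m ^ (1 - r) / r) * (2 * Ch ^ r) := by
        gcongr
        · exact integral_exp_neg_mul_sub_le hm t
        · exact integral_exp_mul_abs_rpow_le hT hCh hloc hbound hkk ht
    _ = (r - 1) / r + (B ^ r * m ^ (1 - r) * (2 * Ch ^ r)) / r := by
        field_simp
    _ ≤ (r - 1) / r + 1 / r := by gcongr
    _ = 1 := by field_simp; ring

/-- Exponential decay of the evolution operator. -/
theorem exp_integral_abs_le (hT : 0 < T) (hCh : 0 < Ch) (hr : 1 < r) (hmeas : Measurable h)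
    (hloc : ∀ a b : ℝ, 0 ≤ a → IntegrableOn (fun τ => |h τ| ^ r) (Set.Icc a b))
    (hbound : ∀ s : ℝ, 0 ≤ s → (∫ τ in s..(s + T), |h τ| ^ r) ≤ Ch ^ r)
    {ρ μ₀ μbar : ℝ} (hρ : 1 < ρ)
    (hμbar : max (2 * ((r - 1) / r) * (2 * Ch ^ r / (r * Real.log ρ)) ^ (1 / (r - 1))) (4 * μ₀) +
        T ^ (-1 / r) * Ch ≤ μbar)
    {s t : ℝ} (hs : 0 ≤ s) (hst : s ≤ t) :
    Real.exp (-μbar * (t - s) + ∫ τ in s..t, |h τ|) ≤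
      ρ ^ ((1 : ℝ) / 2) * Real.exp (-(2 * μ₀) * (t - s)) := by
  have h0 : 0 < r := by linarith
  have h1 : 0 < r - 1 := by linarith
  have hl : 0 < Real.log ρ := Real.log_pos hρ
  set q := 2 * Ch ^ r / (r * Real.log ρ) with hq
  have hq0 : 0 < q := by positivity
  set m := q ^ (1 / (r - 1)) with hmdef
  have hm : 0 < m := by positivity
  have em : m ^ (1 - r) = q⁻¹ := by
    rw [hmdef, ← Real.rpow_mul hq0.le, ← Real.rpow_neg_one]
    congr 1; field_simp; ring
  have e : Ch ^ r * (m ^ (1 - r) / r) = Real.log ρ * (1 / 2) := by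
    have : 0 < Ch ^ r := by positivity
    rw [em, hq]; field_simp
  have key := integral_abs_le_linear hT hCh hr hmeas hloc hbound hm hs hst
  rw [e] at key
  rw [Real.rpow_def_of_pos (by linarith : 0 < ρ), ← Real.exp_add]
  refine Real.exp_le_exp.2 ?_
  have hA1 := le_max_left (2 * ((r - 1) / r) * m) (4 * μ₀)
  have hA2 := le_max_right (2 * ((r - 1) / r) * m) (4 * μ₀)
  have hrate : T ^ (-1 / r) * Ch + (r - 1) / r * m + 2 * μ₀ ≤ μbar := by linarith
  nlinarith [mul_le_mul_of_nonneg_right hrate (sub_nonneg.2 hst)]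

end WindowBounds


/-- Step 1 of the proof of Proposition `ode-stab`: the Duhamel map preserves the ball
`{g : |g(t)| ≤ ρ e^{-μ₀ t} |w₀|}`, where `S(t,s) = exp(-μ̄(t-s) + ∫_s^t |h|)`. -/
theorem stmt_6 (T Ch r : ℝ) (hT : 0 < T) (hCh : 0 < Ch) (hr : 1 < r)
    (h : ℝ → ℝ) (hmeas : Measurable h)
    (hloc : ∀ a b : ℝ, 0 ≤ a → IntegrableOn (fun τ => |h τ| ^ r) (Set.Icc a b))
    (hbound : ∀ s : ℝ, 0 ≤ s → (∫ τ in s..(s + T), |h τ| ^ r) ≤ Ch ^ r)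
    (R p μ ρ c μ₀ μbarstar μbar : ℝ)
    (hR : 0 < R) (hp : 0 < p) (hμ : 0 < μ) (hρ : 1 < ρ) (hc : 1 < c)
    (hμ₀ : μ₀ = max (max μ (Real.log 2 / (p * T)))
      (max ((ρ ^ (2 * p + 1) * R ^ p * Ch / (ρ ^ ((1 : ℝ) / 2) - 1)) ^ (r / (r - 1)) *
          ((r - 1) / r) * 2 ^ (1 / (r - 1)))
        (2 ^ ((r + 1) / (r - 1)) *
          (ρ ^ (2 * p + 1 / 2) * Ch * ((p + 1) / p) * R ^ p * c) ^ (r / (r - 1)) *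
          p ^ (1 / (r - 1)))))
    (hμbarstar : μbarstar =
      max (2 * ((r - 1) / r) * (2 * Ch ^ r / (r * Real.log ρ)) ^ (1 / (r - 1))) (4 * μ₀) +
        T ^ (-1 / r) * Ch)
    (hμbar : μbarstar ≤ μbar)
    (w₀ : ℝ) (hw₀ : |w₀| ≤ ρ * R)
    (wb : ℝ → ℝ) (hwbmeas : Measurable wb)
    (hwb : ∀ t : ℝ, 0 ≤ t → |wb t| ≤ ρ * Real.exp (-μ₀ * t) * |w₀|) :
    ∀ t : ℝ, 0 ≤ t →
      |Real.exp (-μbar * (t - 0) + ∫ τ in (0:ℝ)..t, |h τ|) * w₀ +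
          ∫ τ in (0:ℝ)..t,
            Real.exp (-μbar * (t - τ) + ∫ σ in τ..t, |h σ|) * |h τ| * |wb τ| ^ p * wb τ| ≤
        ρ * Real.exp (-μ₀ * t) * |w₀| := by
  intro t ht
  have hρ0 : 0 < ρ := by linarith
  set σ := ρ ^ ((1 : ℝ) / 2) with hσ
  have hσ1 : 1 < σ := Real.one_lt_rpow hρ (by norm_num)
  have hσσ : σ * σ = ρ := by
    rw [hσ, ← Real.rpow_add hρ0]; norm_num
  have hμle : μ ≤ μ₀ := by
    rw [hμ₀]; exact (le_max_left _ _).trans (le_max_left _ _)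
  have hμ₀pos : 0 < μ₀ := hμ.trans_le hμle
  have hlog : Real.log 2 ≤ p * μ₀ * T := by
    have : Real.log 2 / (p * T) ≤ μ₀ := by
      rw [hμ₀]; exact (le_max_right _ _).trans (le_max_left _ _)
    rw [div_le_iff₀ (by positivity)] at this
    linarith
  set B := ρ ^ (2 * p + 1) * R ^ p / (σ - 1) with hBdef
  have hB : 0 < B := div_pos (by positivity) (by linarith)
  have hBμ : (B * Ch) ^ (r / (r - 1)) * ((r - 1) / r) * 2 ^ (1 / (r - 1)) ≤ μ₀ := by
    have e : B * Ch = ρ ^ (2 * p + 1) * R ^ p * Ch / (σ - 1) := by rw [hBdef]; ring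
    rw [e, hμ₀]
    exact (le_max_left _ _).trans (le_max_right _ _)
  have hS : ∀ {s : ℝ}, 0 ≤ s → s ≤ t →
      Real.exp (-μbar * (t - s) + ∫ τ in s..t, |h τ|) ≤ σ * Real.exp (-(2 * μ₀) * (t - s)) :=
    fun hs hst => exp_integral_abs_le hT hCh hr hmeas hloc hbound hρ (hμbarstar ▸ hμbar) hs hst
  obtain ⟨hgi, hgle⟩ :=
    integral_young_majorant_le hT hCh hr hloc hbound hp hB hμ₀pos hlog hBμ ht
  have hK : 0 ≤ Real.exp (-μ₀ * t) * |w₀| * σ * (σ - 1) :=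
    mul_nonneg (by positivity) (by linarith)
  have hpt : ∀ τ ∈ Set.Ioc 0 t,
      ‖Real.exp (-μbar * (t - τ) + ∫ σ in τ..t, |h σ|) * |h τ| * |wb τ| ^ p * wb τ‖ ≤
        Real.exp (-μ₀ * t) * |w₀| * σ * (σ - 1) *
          ((r - 1) / r * (r / (r - 1) * μ₀) * Real.exp (r / (r - 1) * (-μ₀ * (t - τ))) +
            (B * Real.exp (-(p * μ₀) * τ) * |h τ|) ^ r *
              ((r / (r - 1) * μ₀) ^ (1 - r) / r)) := by
    intro τ hτ
    have hw := hwb τ hτ.1.le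
    have hwp : |wb τ| ^ p ≤ ρ ^ (2 * p) * R ^ p * Real.exp (-(p * μ₀) * τ) := by
      have h1 : |wb τ| ≤ ρ * Real.exp (-μ₀ * τ) * (ρ * R) :=
        hw.trans (mul_le_mul_of_nonneg_left hw₀ (by positivity))
      refine (Real.rpow_le_rpow (abs_nonneg _) h1 hp.le).trans (le_of_eq ?_)
      rw [Real.mul_rpow (by positivity) (by positivity),
        Real.mul_rpow hρ0.le (by positivity), Real.mul_rpow hρ0.le hR.le, ← Real.exp_mul,
        two_mul p, Real.rpow_add hρ0, (by ring : -μ₀ * τ * p = -(p * μ₀) * τ)]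
      ring
    have hy := exp_mul_le_add_rpow (u := -μ₀ * (t - τ)) hr
      (by positivity : 0 ≤ B * Real.exp (-(p * μ₀) * τ) * |h τ|)
      (mul_pos (div_pos (by linarith) (by linarith)) hμ₀pos : 0 < r / (r - 1) * μ₀)
    refine le_trans ?_ (mul_le_mul_of_nonneg_left hy hK)
    rw [Real.norm_eq_abs, abs_mul, abs_mul, abs_mul, Real.abs_exp, abs_abs,
      abs_of_nonneg (Real.rpow_nonneg (abs_nonneg (wb τ)) p)]
    calc _ ≤ (σ * Real.exp (-(2 * μ₀) * (t - τ))) * |h τ| *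
          (ρ ^ (2 * p) * R ^ p * Real.exp (-(p * μ₀) * τ)) *
            (ρ * Real.exp (-μ₀ * τ) * |w₀|) := by
          gcongr
          exact hS hτ.1.le hτ.2
      _ = _ := by
          have e1 : Real.exp (-(2 * μ₀) * (t - τ)) * Real.exp (-μ₀ * τ) =
              Real.exp (-μ₀ * t) * Real.exp (-μ₀ * (t - τ)) := by
            rw [← Real.exp_add, ← Real.exp_add]; congr 1; ring
          have e2 : (σ - 1) * B = ρ ^ (2 * p) * ρ * R ^ p := by
            have : σ - 1 ≠ 0 := by linarith
            rw [hBdef, Real.rpow_add_one hρ0.ne']; field_simp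
          linear_combination
            (σ * |h τ| * ρ ^ (2 * p) * R ^ p * Real.exp (-(p * μ₀) * τ) * ρ * |w₀|) * e1 -
              (Real.exp (-μ₀ * t) * |w₀| * σ * Real.exp (-μ₀ * (t - τ)) *
                Real.exp (-(p * μ₀) * τ) * |h τ|) * e2
  have hint := intervalIntegral.norm_integral_le_of_norm_le ht
    (Filter.Eventually.of_forall hpt) (hgi.const_mul _)
  rw [intervalIntegral.integral_const_mul, Real.norm_eq_abs] at hint
  have hint2 := hint.trans (mul_le_mul_of_nonneg_left hgle hK)
  have hlin : |Real.exp (-μbar * (t - 0) + ∫ τ in (0:ℝ)..t, |h τ|) * w₀| ≤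
      σ * Real.exp (-μ₀ * t) * |w₀| := by
    rw [abs_mul, Real.abs_exp]
    refine mul_le_mul_of_nonneg_right ((hS le_rfl ht).trans ?_) (abs_nonneg _)
    refine mul_le_mul_of_nonneg_left (Real.exp_le_exp.2 ?_) (by linarith)
    nlinarith [mul_nonneg hμ₀pos.le ht]
  refine (abs_add_le _ _).trans ((add_le_add hlin hint2).trans (le_of_eq ?_))
  rw [← hσσ]; ring
end

section
/- If a polynomial p of degree at most 1, p(x) = c₀ + Σ_{i=1}^d a_i x_i, satisfies ∫_{ω_j} p(x) dx = 0 for every j ∈ J_{d,2}, then c₀ = 0 and a_i = 0 for all 1 ≤ i ≤ d, i.e. p is identically zero. Equivalently, the seminorm p ↦ ( Σ_{j ∈ J_{d,2}} (∫_{ω_j} p(x) dx)² )^{1/2} is a norm on the (d+1)-dimensional space of polynomials of degree at most 1 on ℝ^d. -/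
open MeasureTheory

/-- The multi-indices of the set `J_{d,2}`: `jidx none` is the all-ones index `𝟏`, and
`jidx (some i)` is the index `𝟏 + τ^i`, with entry `2` at position `i` and `1` elsewhere. -/
def jidx {d : ℕ} [DecidableEq (Fin d)] : Option (Fin d) → Fin d → ℕ
  | none, _ => 1
  | some i, k => if k = i then 2 else 1

/-- The sensor box `ω_j ⊂ ℝ^d` associated with a multi-index `j ∈ {1,2}^d`:
`ω_j = ∏_k ( (2 j_k - 1) L_k / 4 - r L_k / 4 , (2 j_k - 1) L_k / 4 - r L_k / 4 + r L_k / 2 )`. -/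
def sensorBox {d : ℕ} (L : Fin d → ℝ) (r : ℝ) (j : Fin d → ℕ) : Set (Fin d → ℝ) :=
  Set.univ.pi fun k =>
    Set.Ioo ((2 * (j k : ℝ) - 1) * L k / 4 - r * L k / 4)
      ((2 * (j k : ℝ) - 1) * L k / 4 - r * L k / 4 + r * L k / 2)

/-- The integral of an affine function over a set of finite measure which is symmetric
about `m` is its value at `m` times the measure of the set. -/
theorem setIntegral_affine_of_symmetric {d : ℕ} {s : Set (Fin d → ℝ)} {m : Fin d → ℝ}
    (hsymm : (fun x => m + m - x) ⁻¹' s = s) (hs : volume s ≠ ⊤) (c₀ : ℝ) (a : Fin d → ℝ)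
    (hint : IntegrableOn (fun x => c₀ + ∑ i, a i * x i) s) :
    ∫ x in s, (c₀ + ∑ i, a i * x i) = volume.real s * (c₀ + ∑ i, a i * m i) := by
  have hmp : MeasurePreserving (fun x : Fin d → ℝ => m + m - x) volume volume :=
    Measure.measurePreserving_sub_left volume (m + m)
  have hemb : MeasurableEmbedding (fun x : Fin d → ℝ => m + m - x) :=
    (Homeomorph.subLeft (m + m)).measurableEmbedding
  have hrefl := hmp.setIntegral_preimage_emb hemb (fun x => c₀ + ∑ i, a i * x i) s
  have hpoint : ∀ x : Fin d → ℝ, c₀ + ∑ i, a i * (m + m - x) i =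
      2 * (c₀ + ∑ i, a i * m i) - (c₀ + ∑ i, a i * x i) := fun x => by
    simp only [Pi.sub_apply, Pi.add_apply, mul_sub, mul_add, Finset.sum_sub_distrib,
      Finset.sum_add_distrib]
    ring
  rw [hsymm] at hrefl
  simp only [hpoint] at hrefl
  rw [integral_sub (integrableOn_const (μ := volume) hs).integrable hint, setIntegral_const, smul_eq_mul] at hrefl
  linarith

/-- The center of the box `ω_j`. -/
noncomputable def sensorCenter {d : ℕ} (L : Fin d → ℝ) (j : Fin d → ℕ) : Fin d → ℝ :=
  fun k => (2 * (j k : ℝ) - 1) * L k / 4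

theorem sensorBox_symmetric {d : ℕ} (L : Fin d → ℝ) (r : ℝ) (j : Fin d → ℕ) :
    (fun x => sensorCenter L j + sensorCenter L j - x) ⁻¹' sensorBox L r j =
      sensorBox L r j := by
  ext x
  simp only [sensorBox, sensorCenter, Set.mem_preimage, Set.mem_univ_pi, Set.mem_Ioo,
    Pi.sub_apply, Pi.add_apply]
  refine forall_congr' fun k => ?_
  constructor <;> rintro ⟨h₁, h₂⟩ <;> constructor <;> linarith

theorem isBounded_sensorBox {d : ℕ} (L : Fin d → ℝ) (r : ℝ) (j : Fin d → ℕ) :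
    Bornology.IsBounded (sensorBox L r j) :=
  Bornology.IsBounded.pi fun _ => Metric.isBounded_Ioo _ _

theorem measureReal_sensorBox_pos {d : ℕ} {L : Fin d → ℝ} (hL : ∀ k, 0 < L k) {r : ℝ}
    (hr : 0 < r) (j : Fin d → ℕ) : 0 < volume.real (sensorBox L r j) := by
  have hopen : IsOpen (sensorBox L r j) :=
    isOpen_set_pi Set.finite_univ fun _ _ => isOpen_Ioo
  have hne : (sensorBox L r j).Nonempty := by
    refine ⟨sensorCenter L j, fun k _ => ?_⟩
    have := mul_pos hr (hL k)
    constructor <;> simp only [sensorCenter] <;> linarith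
  exact ENNReal.toReal_pos (hopen.measure_pos volume hne).ne'
    (isBounded_sensorBox L r j).measure_lt_top.ne

/-- An affine function with zero integral over `ω_j` vanishes at the center of `ω_j`. -/
theorem affine_sensorCenter_eq_zero {d : ℕ} {L : Fin d → ℝ} (hL : ∀ k, 0 < L k) {r : ℝ}
    (hr : 0 < r) (j : Fin d → ℕ) {c₀ : ℝ} {a : Fin d → ℝ}
    (h : ∫ x in sensorBox L r j, (c₀ + ∑ i, a i * x i) = 0) :
    c₀ + ∑ i, a i * sensorCenter L j i = 0 := by
  have hbdd := isBounded_sensorBox L r j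
  have hint : IntegrableOn (fun x : Fin d → ℝ => c₀ + ∑ i, a i * x i) (sensorBox L r j) :=
    (Continuous.continuousOn (by fun_prop)).integrableOn_compact hbdd.isCompact_closure
      |>.mono_set subset_closure
  rw [setIntegral_affine_of_symmetric (sensorBox_symmetric L r j) hbdd.measure_lt_top.ne c₀ a
    hint] at h
  exact (mul_eq_zero.mp h).resolve_left (measureReal_sensorBox_pos hL hr j).ne'

/-- Proposition `normPoly`: if a polynomial `p(x) = c₀ + ∑ i, a i * x i` of degree at most
one has vanishing averages over the `d+1` sensor boxes `ω_j`, `j ∈ J_{d,2}`, then `p = 0`;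
i.e. the seminorm `𝔖` is a norm on the space of polynomials of degree at most one. -/
theorem stmt_9 (d : ℕ) (hd : 1 ≤ d) (L : Fin d → ℝ) (hL : ∀ k, 0 < L k)
    (r : ℝ) (hr : r ∈ Set.Ioo (0 : ℝ) 1) (c₀ : ℝ) (a : Fin d → ℝ)
    (hzero : ∀ o : Option (Fin d),
      (∫ x : Fin d → ℝ in sensorBox L r (jidx o), (c₀ + ∑ i, a i * x i)) = 0) :
    c₀ = 0 ∧ ∀ i, a i = 0 := by
  have hcenter o := affine_sensorCenter_eq_zero hL hr.1 (jidx o) (hzero o)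
  have ha : ∀ i, a i = 0 := fun i => by
    have hdiff : ∑ k, a k * sensorCenter L (jidx (some i)) k -
        ∑ k, a k * sensorCenter L (jidx none) k = a i * (L i / 2) := by
      rw [← Finset.sum_sub_distrib, Finset.sum_eq_single i]
      · simp only [sensorCenter, jidx, if_true]
        push_cast
        ring
      · intro k _ hk
        simp [sensorCenter, jidx, hk]
      · simp
    have hzero' : a i * (L i / 2) = 0 := by linarith [hcenter (some i), hcenter none]
    exact (mul_eq_zero.mp hzero').resolve_right (half_pos (hL i)).ne'
  exact ⟨by simpa [ha] using hcenter none, ha⟩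
end

section
/- For every real coefficient vector (θ₁, …, θ_K), the function θ := Σ_{k=1}^K θ_k Φ_k satisfies ν·∫_{ℝ^d} |∇θ(x)|² dx + ∫_{ℝ^d} θ(x)² dx = (C₁·S² + 1)·∫_{ℝ^d} θ(x)² dx, where C₁ := (4νπ²/3)·Σ_{j=1}^d 1/L_j². -/
open MeasureTheory Real

/-- The open box `B_k = ∏_j (a_j, a_j + L_j/S)` with lower corner `a`. -/
def obsBox {d : ℕ} (S : ℕ) (L : Fin d → ℝ) (a : Fin d → ℝ) : Set (Fin d → ℝ) :=
  Set.univ.pi fun j => Set.Ioo (a j) (a j + L j / S)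

/-- The bump function `Φ` supported on the closure of the box with lower corner `a`:
`Φ(x) = ∏_j sin²(Sπ (x_j - a_j)/L_j)` for `x` in the closure of the box, `Φ(x) = 0`
otherwise. -/
noncomputable def obsBump {d : ℕ} (S : ℕ) (L : Fin d → ℝ) (a : Fin d → ℝ) :
    (Fin d → ℝ) → ℝ :=
  (closure (obsBox S L a)).indicator fun x =>
    ∏ j, Real.sin (S * π * (x j - a j) / L j) ^ 2

/-- The one-dimensional profile `sin² (π (t - a) / ℓ)` on `(a, a + ℓ)`, extended by zero. -/
noncomputable def sinSqBump (a ℓ : ℝ) : ℝ → ℝ :=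
  (Set.Ioo a (a + ℓ)).indicator fun t => sin (π / ℓ * (t - a)) ^ 2

/-- The derivative of `sinSqBump a ℓ`. -/
noncomputable def sinSqBumpDeriv (a ℓ : ℝ) : ℝ → ℝ :=
  (Set.Ioo a (a + ℓ)).indicator fun t =>
    2 * (π / ℓ) * (sin (π / ℓ * (t - a)) * cos (π / ℓ * (t - a)))

lemma sin_pi_div_mul_sub_sq_eq_zero {a ℓ t : ℝ} (hℓ : 0 < ℓ) (ht : t ∈ Set.Icc a (a + ℓ))
    (ht' : t ∉ Set.Ioo a (a + ℓ)) : sin (π / ℓ * (t - a)) ^ 2 = 0 := by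
  obtain rfl | h := ht.1.eq_or_lt
  · simp
  · obtain rfl : t = a + ℓ := le_antisymm ht.2 (not_lt.1 fun h' => ht' ⟨h, h'⟩)
    simp [div_mul_cancel₀ π hℓ.ne']

lemma sinSqBump_le {a ℓ s t : ℝ} (hℓ : 0 < ℓ) (ht : t ∉ Set.Ioo a (a + ℓ)) :
    |sinSqBump a ℓ s| ≤ (π / ℓ) ^ 2 * |s - t| ^ 2 := by
  unfold sinSqBump
  by_cases hs : s ∈ Set.Ioo a (a + ℓ)
  · rw [Set.indicator_of_mem hs, abs_pow, ← mul_pow]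
    have hc : 0 < π / ℓ := by positivity
    refine pow_le_pow_left₀ (abs_nonneg _) ?_ 2
    rcases le_or_gt t a with hta | hta
    · refine abs_sin_le_abs.trans ?_
      rw [abs_mul, abs_of_pos hc, abs_of_pos (sub_pos.2 hs.1),
        abs_of_pos (sub_pos.2 (hta.trans_lt hs.1))]
      gcongr
    · have htb : a + ℓ ≤ t := not_lt.1 fun h => ht ⟨hta, h⟩
      have h : π / ℓ * (s - a) = π - π / ℓ * (a + ℓ - s) := by field_simp; ring
      rw [h, sin_pi_sub]
      refine abs_sin_le_abs.trans ?_
      rw [abs_mul, abs_of_pos hc, abs_of_pos (sub_pos.2 hs.2), abs_sub_comm,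
        abs_of_pos (sub_pos.2 (hs.2.trans_le htb))]
      gcongr
  · rw [Set.indicator_of_notMem hs, abs_zero]
    positivity

lemma hasDerivAt_sinSqBump {a ℓ : ℝ} (hℓ : 0 < ℓ) (t : ℝ) :
    HasDerivAt (sinSqBump a ℓ) (sinSqBumpDeriv a ℓ t) t := by
  by_cases ht : t ∈ Set.Ioo a (a + ℓ)
  · have h : HasDerivAt (fun t => sin (π / ℓ * (t - a)) ^ 2) (sinSqBumpDeriv a ℓ t) t := by
      have := ((((hasDerivAt_id t).sub_const a).const_mul (π / ℓ)).sin).pow 2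
      refine this.congr_deriv ?_
      rw [sinSqBumpDeriv, Set.indicator_of_mem ht]
      simp
      ring
    refine h.congr_of_eventuallyEq ?_
    filter_upwards [isOpen_Ioo.mem_nhds ht] with s hs
    exact Set.indicator_of_mem hs _
  · rw [sinSqBumpDeriv, Set.indicator_of_notMem ht]
    have h : HasFDerivAt (sinSqBump a ℓ) (0 : ℝ →L[ℝ] ℝ) t := by
      refine Asymptotics.IsBigO.hasFDerivAt (n := 2)
        (Asymptotics.IsBigO.of_bound ((π / ℓ) ^ 2) (.of_forall fun s => ?_)) one_lt_two
      simpa using sinSqBump_le (s := s) hℓ ht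
    simpa using h.hasDerivAt

lemma integrable_indicator_Ioo {f : ℝ → ℝ} (hf : Continuous f) (a b : ℝ) :
    Integrable ((Set.Ioo a b).indicator f) :=
  (integrable_indicator_iff measurableSet_Ioo).2
    ((hf.integrableOn_Icc (a := a) (b := b)).mono_set Set.Ioo_subset_Icc_self)

lemma integral_indicator_Ioo_comp {a ℓ : ℝ} (hℓ : 0 < ℓ) (g : ℝ → ℝ) :
    ∫ t, (Set.Ioo a (a + ℓ)).indicator (fun t => g (π / ℓ * (t - a))) t =
      ℓ / π * ∫ u in (0 : ℝ)..π, g u := by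
  rw [integral_indicator measurableSet_Ioo, ← integral_Ioc_eq_integral_Ioo,
    ← intervalIntegral.integral_of_le (by linarith)]
  simp_rw [mul_sub]
  rw [intervalIntegral.integral_comp_mul_sub g (by positivity), smul_eq_mul, inv_div]
  congr 2 <;> field_simp <;> ring

lemma sinSqBump_sq (a ℓ t : ℝ) : sinSqBump a ℓ t ^ 2 =
    (Set.Ioo a (a + ℓ)).indicator (fun t => sin (π / ℓ * (t - a)) ^ 4) t := by
  by_cases h : t ∈ Set.Ioo a (a + ℓ) <;> simp [sinSqBump, h, ← pow_mul]

lemma sinSqBumpDeriv_sq (a ℓ t : ℝ) : sinSqBumpDeriv a ℓ t ^ 2 =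
    (Set.Ioo a (a + ℓ)).indicator (fun t => 4 * (π / ℓ) ^ 2 *
      (sin (π / ℓ * (t - a)) ^ 2 * cos (π / ℓ * (t - a)) ^ 2)) t := by
  by_cases h : t ∈ Set.Ioo a (a + ℓ)
  · simp only [sinSqBumpDeriv, Set.indicator_of_mem h]
    ring
  · simp [sinSqBumpDeriv, h]

lemma integrable_sinSqBump_sq (a ℓ : ℝ) : Integrable fun t => sinSqBump a ℓ t ^ 2 := by
  simp_rw [sinSqBump_sq]
  exact integrable_indicator_Ioo (by fun_prop) _ _

lemma integrable_sinSqBumpDeriv_sq (a ℓ : ℝ) : Integrable fun t => sinSqBumpDeriv a ℓ t ^ 2 := by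
  simp_rw [sinSqBumpDeriv_sq]
  exact integrable_indicator_Ioo (by fun_prop) _ _

lemma integral_sinSqBumpDeriv_sq (a : ℝ) {ℓ : ℝ} (hℓ : 0 < ℓ) :
    ∫ t, sinSqBumpDeriv a ℓ t ^ 2 = 4 / 3 * (π / ℓ) ^ 2 * ∫ t, sinSqBump a ℓ t ^ 2 := by
  simp_rw [sinSqBumpDeriv_sq, sinSqBump_sq]
  rw [integral_indicator_Ioo_comp hℓ fun u => 4 * (π / ℓ) ^ 2 * (sin u ^ 2 * cos u ^ 2),
    integral_indicator_Ioo_comp hℓ fun u => sin u ^ 4, intervalIntegral.integral_const_mul,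
    integral_sin_sq_mul_cos_sq, integral_sin_pow (n := 2), integral_sin_sq]
  have : sin (4 * π) = 0 := by simpa using sin_nat_mul_pi 4
  simp [this]
  ring

section Box

variable {d : ℕ} {S : ℕ} {L : Fin d → ℝ}

lemma obsBump_eq_prod (hS : 0 < S) (hL : ∀ j, 0 < L j) (a x : Fin d → ℝ) :
    obsBump S L a x = ∏ j, sinSqBump (a j) (L j / S) (x j) := by
  have hℓ (j) : 0 < L j / S := div_pos (hL j) (by exact_mod_cast hS)
  have harg (j) : (S : ℝ) * π * (x j - a j) / L j = π / (L j / S) * (x j - a j) := by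
    have := hL j
    field_simp
  have hcl : closure (obsBox S L a) = Set.univ.pi fun j => Set.Icc (a j) (a j + L j / S) := by
    rw [obsBox, closure_pi_set]
    congr! 2 with j
    exact closure_Ioo (by linarith [hℓ j])
  unfold obsBump
  rw [hcl]
  by_cases hx : x ∈ Set.univ.pi fun j => Set.Icc (a j) (a j + L j / S)
  · rw [Set.indicator_of_mem hx]
    refine Finset.prod_congr rfl fun j _ => ?_
    rw [harg, sinSqBump]
    by_cases hj : x j ∈ Set.Ioo (a j) (a j + L j / S)
    · rw [Set.indicator_of_mem hj]
    · rw [Set.indicator_of_notMem hj, sin_pi_div_mul_sub_sq_eq_zero (hℓ j) (hx j trivial) hj]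
  · rw [Set.indicator_of_notMem hx]
    simp only [Set.mem_univ_pi, not_forall] at hx
    obtain ⟨j, hj⟩ := hx
    refine (Finset.prod_eq_zero (Finset.mem_univ j) ?_).symm
    exact Set.indicator_of_notMem (fun h => hj (Set.Ioo_subset_Icc_self h)) _

/-- The partial derivative of `obsBump S L a` in the `i`-th coordinate direction. -/
noncomputable def obsBumpPartial (S : ℕ) (L : Fin d → ℝ) (a : Fin d → ℝ) (i : Fin d)
    (x : Fin d → ℝ) : ℝ :=
  ∏ j, if j = i then sinSqBumpDeriv (a j) (L j / S) (x j) else sinSqBump (a j) (L j / S) (x j)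

lemma obsBump_eq_zero_of_notMem (hS : 0 < S) (hL : ∀ j, 0 < L j) {a x : Fin d → ℝ}
    (hx : x ∉ obsBox S L a) : obsBump S L a x = 0 := by
  rw [obsBump_eq_prod hS hL]
  simp only [obsBox, Set.mem_univ_pi, not_forall] at hx
  obtain ⟨j, hj⟩ := hx
  exact Finset.prod_eq_zero (Finset.mem_univ j) (Set.indicator_of_notMem hj _)

lemma obsBumpPartial_eq_zero_of_notMem {a x : Fin d → ℝ} (i : Fin d)
    (hx : x ∉ obsBox S L a) : obsBumpPartial S L a i x = 0 := by
  simp only [obsBox, Set.mem_univ_pi, not_forall] at hx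
  obtain ⟨j, hj⟩ := hx
  refine Finset.prod_eq_zero (Finset.mem_univ j) ?_
  split_ifs
  · exact Set.indicator_of_notMem hj _
  · exact Set.indicator_of_notMem hj _

lemma hasFDerivAt_obsBump (hS : 0 < S) (hL : ∀ j, 0 < L j) (a x : Fin d → ℝ) :
    HasFDerivAt (obsBump S L a)
      (∑ i, obsBumpPartial S L a i x • ContinuousLinearMap.proj (R := ℝ) (φ := fun _ => ℝ) i) x := by
  have hℓ (j) : 0 < L j / S := div_pos (hL j) (by exact_mod_cast hS)
  rw [show obsBump S L a = fun x => ∏ j, sinSqBump (a j) (L j / S) (x j) from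
    funext (obsBump_eq_prod hS hL a)]
  have h := HasFDerivAt.finsetProd (u := Finset.univ) (x := x) fun j _ =>
    (hasDerivAt_sinSqBump (a := a j) (hℓ j) (x j)).comp_hasFDerivAt x
      (ContinuousLinearMap.proj (R := ℝ) (φ := fun _ : Fin d => ℝ) j).hasFDerivAt
  refine h.congr_fderiv (Finset.sum_congr rfl fun i _ => ?_)
  rw [smul_smul, obsBumpPartial, ← Finset.prod_erase_mul _ _ (Finset.mem_univ i), if_pos rfl]
  congr 2
  exact Finset.prod_congr rfl fun j hj => (if_neg (Finset.ne_of_mem_erase hj)).symm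

lemma fderiv_sum_obsBump_apply_single (hS : 0 < S) (hL : ∀ j, 0 < L j) {K : ℕ}
    (a : Fin K → Fin d → ℝ) (c : Fin K → ℝ) (x : Fin d → ℝ) (i : Fin d) :
    fderiv ℝ (fun y => ∑ k, c k * obsBump S L (a k) y) x (Pi.single i 1) =
      ∑ k, c k * obsBumpPartial S L (a k) i x := by
  rw [(HasFDerivAt.fun_sum fun k _ =>
    (hasFDerivAt_obsBump hS hL (a k) x).const_mul (c k)).fderiv]
  simp [Pi.single_apply]

lemma integrable_obsBump_sq (hS : 0 < S) (hL : ∀ j, 0 < L j) (a : Fin d → ℝ) :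
    Integrable fun x => obsBump S L a x ^ 2 := by
  simp_rw [obsBump_eq_prod hS hL, ← Finset.prod_pow]
  exact Integrable.fintype_prod (f := fun j t => sinSqBump (a j) (L j / S) t ^ 2)
    fun j => integrable_sinSqBump_sq _ _

lemma integrable_obsBumpPartial_sq (a : Fin d → ℝ) (i : Fin d) :
    Integrable fun x => obsBumpPartial S L a i x ^ 2 := by
  simp_rw [obsBumpPartial, ← Finset.prod_pow]
  refine Integrable.fintype_prod (f := fun j t => (if j = i then
    sinSqBumpDeriv (a j) (L j / S) t else sinSqBump (a j) (L j / S) t) ^ 2) fun j => ?_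
  by_cases h : j = i
  · simpa [h] using integrable_sinSqBumpDeriv_sq _ _
  · simpa [h] using integrable_sinSqBump_sq _ _

lemma integral_obsBumpPartial_sq (hS : 0 < S) (hL : ∀ j, 0 < L j) (a : Fin d → ℝ) (i : Fin d) :
    ∫ x, obsBumpPartial S L a i x ^ 2 =
      4 / 3 * (π / (L i / S)) ^ 2 * ∫ x, obsBump S L a x ^ 2 := by
  have hℓ (j) : 0 < L j / S := div_pos (hL j) (by exact_mod_cast hS)
  simp_rw [obsBumpPartial, obsBump_eq_prod hS hL, ← Finset.prod_pow]
  rw [integral_fintype_prod_volume_eq_prod fun j t => (if j = i then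
      sinSqBumpDeriv (a j) (L j / S) t else sinSqBump (a j) (L j / S) t) ^ 2,
    integral_fintype_prod_volume_eq_prod fun j t => sinSqBump (a j) (L j / S) t ^ 2,
    ← Finset.mul_prod_erase _ _ (Finset.mem_univ i),
    ← Finset.mul_prod_erase (a := i) Finset.univ
      (fun j => ∫ t, sinSqBump (a j) (L j / S) t ^ 2) (Finset.mem_univ i), ← mul_assoc,
    ← integral_sinSqBumpDeriv_sq (a i) (hℓ i)]
  simp only [if_true]
  congr 1
  refine Finset.prod_congr rfl fun j hj => ?_
  simp [Finset.ne_of_mem_erase hj]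

end Box

lemma sq_sum_eq_sum_sq_of_disjoint {α ι : Type*} [Fintype ι] {s : ι → Set α}
    (hs : ∀ k l, k ≠ l → Disjoint (s k) (s l)) (c : ι → ℝ) {f : ι → α → ℝ}
    (hf : ∀ k x, x ∉ s k → f k x = 0) (x : α) :
    (∑ k, c k * f k x) ^ 2 = ∑ k, c k ^ 2 * f k x ^ 2 := by
  rw [sq, Finset.sum_mul_sum]
  refine Finset.sum_congr rfl fun k _ => ?_
  rw [Finset.sum_eq_single k]
  · ring
  · intro l _ hl
    by_cases hx : x ∈ s k
    · rw [hf l x (Set.disjoint_left.1 (hs k l hl.symm) hx)]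
      ring
    · rw [hf k x hx]
      ring
  · simp

/-- Proposition `underAlpha` (first identity): for `θ = ∑ k, θ_k Φ_k` with the `Φ_k`
supported on pairwise disjoint boxes,
`ν ∫ |∇θ|² + ∫ θ² = (C₁ S² + 1) ∫ θ²` with `C₁ = (4νπ²/3) ∑_j 1/L_j²`. -/
theorem stmt_12 (d : ℕ) (hd : 1 ≤ d) (S : ℕ) (hS : 0 < S)
    (L : Fin d → ℝ) (hL : ∀ j, 0 < L j) (ν : ℝ) (hν : 0 < ν)
    (K : ℕ) (a : Fin K → Fin d → ℝ)
    (hdisj : ∀ k l : Fin K, k ≠ l → Disjoint (obsBox S L (a k)) (obsBox S L (a l)))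
    (θc : Fin K → ℝ) :
    ν * (∫ x : Fin d → ℝ,
          ∑ i, (fderiv ℝ (fun y : Fin d → ℝ => ∑ k, θc k * obsBump S L (a k) y) x
              (Pi.single i 1)) ^ 2) +
        (∫ x : Fin d → ℝ, (∑ k, θc k * obsBump S L (a k) x) ^ 2) =
      ((4 * ν * π ^ 2 / 3) * (∑ j, 1 / L j ^ 2) * S ^ 2 + 1) *
        ∫ x : Fin d → ℝ, (∑ k, θc k * obsBump S L (a k) x) ^ 2 := by
  have hsq (x) := sq_sum_eq_sum_sq_of_disjoint hdisj θc
    (fun k _ => obsBump_eq_zero_of_notMem hS hL (a := a k)) x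
  have hgrad (x) (i) := sq_sum_eq_sum_sq_of_disjoint hdisj θc
    (fun k _ => obsBumpPartial_eq_zero_of_notMem (a := a k) i) x
  simp_rw [fderiv_sum_obsBump_apply_single hS hL, hgrad, hsq]
  rw [integral_finsetSum _ fun i _ => integrable_finsetSum _ fun k _ =>
      (integrable_obsBumpPartial_sq (a k) i).const_mul _,
    integral_finsetSum _ fun k _ => (integrable_obsBump_sq hS hL (a k)).const_mul _]
  have hi (i : Fin d) : ∫ x, ∑ k, θc k ^ 2 * obsBumpPartial S L (a k) i x ^ 2 =
      4 * π ^ 2 / 3 * S ^ 2 * (1 / L i ^ 2) *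
        ∑ k, ∫ x, θc k ^ 2 * obsBump S L (a k) x ^ 2 := by
    rw [integral_finsetSum _ fun k _ => (integrable_obsBumpPartial_sq (a k) i).const_mul _,
      Finset.mul_sum]
    refine Finset.sum_congr rfl fun k _ => ?_
    rw [integral_const_mul, integral_const_mul, integral_obsBumpPartial_sq hS hL]
    have := (hL i).ne'
    field_simp
  simp_rw [hi]
  rw [← Finset.sum_mul, ← Finset.mul_sum]
  ring
end
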